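/- arXiv:1406.0199 — 2 statements merged into one kernel-verified Lean document; each statement's English description precedes it below -/
import Mathlib

section
/- Let $n, \alpha \geq 2$ and let $R$ be a reduced commutative ring with unity such that $n!$ is not a zero-divisor in $R$. Let $\tilde{R} = R[a_{1,1}, \dots, a_{n,n}]$ be the polynomial ring over $R$ in $n^2$ commuting indeterminates, and let $A = [a_{i,j}] \in M_n(\tilde{R})$ be the generic matrix whose $(i,j)$ entry is the indeterminate $a_{i,j}$. Then $X = 0$ is the only matrix $X \in M_n(\tilde{R})$ satisfying $AX - XA = X^{\alpha}$. -/
open Polynomial in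
/-- `[A, X] = X ^ α` implies `[A, X ^ (k+1)] = (k+1) X ^ (k + α)`. -/
theorem aux_comm_pow {S : Type*} [Ring S] (A X : S) (α : ℕ) (h : A * X - X * A = X ^ α) (k : ℕ) :
    A * X ^ (k + 1) - X ^ (k + 1) * A = ((k + 1 : ℕ) : S) * X ^ (k + α) := by
  induction k with
  | zero => simpa using h
  | succ k ih =>
    have e : A * X ^ (k + 1 + 1) - X ^ (k + 1 + 1) * A
        = (A * X ^ (k + 1) - X ^ (k + 1) * A) * X + X ^ (k + 1) * (A * X - X * A) := by
      rw [pow_succ X (k + 1)]; noncomm_ring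
    rw [e, ih, h, mul_assoc, ← pow_succ, ← pow_add,
      show k + α + 1 = k + 1 + α by ring]
    push_cast
    noncomm_ring

/-- A solution has vanishing traces of large powers. -/
theorem aux_trace {n : ℕ} {K : Type*} [Field K] (A X : Matrix (Fin n) (Fin n) K) (α : ℕ)
    (h : A * X - X * A = X ^ α) (k : ℕ) : (X ^ (α + k)).trace = 0 := by
  rw [pow_add, ← h, sub_mul, Matrix.trace_sub, mul_assoc, mul_assoc, sub_eq_zero,
    Matrix.trace_mul_comm X, mul_assoc, ← pow_succ, ← pow_succ']

open Polynomial in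
/-- If all large powers have trace zero and `n!` is invertible then the matrix is nilpotent. -/
theorem aux_nilp {n : ℕ} {K : Type*} [Field K] (hfac : (n.factorial : K) ≠ 0)
    (Y : Matrix (Fin n) (Fin n) K) (α : ℕ)
    (h : ∀ k, (Y ^ (α + k)).trace = 0) : IsNilpotent Y := by
  have hc0 : Y.charpoly ≠ 0 := Y.charpoly_monic.ne_zero
  obtain ⟨q, hq, hqr⟩ := Polynomial.exists_eq_pow_rootMultiplicity_mul_and_not_dvd Y.charpoly hc0 0
  set m := Y.charpoly.rootMultiplicity 0
  simp only [map_zero, sub_zero] at hq hqr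
  have hcop : IsCoprime ((X : K[X]) ^ (α + m)) q := by
    apply IsCoprime.pow_left
    exact (Polynomial.irreducible_X.coprime_iff_not_dvd).2 hqr
  obtain ⟨u, v, huv⟩ := hcop
  obtain ⟨E, hE⟩ : ∃ E : K[X], E = u * X ^ (α + m) := ⟨_, rfl⟩
  have htr : ∀ w : K[X], (aeval Y (w * X ^ (α + m))).trace = 0 := by
    intro w
    induction w using Polynomial.induction_on' with
    | add p q hp hq => rw [add_mul, map_add, Matrix.trace_add, hp, hq, add_zero]
    | monomial i a =>
      have : (monomial i a * X ^ (α + m) : K[X]) = C a * X ^ (α + (i + m)) := by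
        rw [← C_mul_X_pow_eq_monomial]; ring
      rw [this, map_mul, aeval_C, map_pow, aeval_X, ← Algebra.smul_def, Matrix.trace_smul, h,
        smul_zero]
  have hz : aeval Y (X ^ (α + m) * q) = 0 := by
    have : (X ^ (α + m) * q : K[X]) = X ^ α * Y.charpoly := by
      rw [hq]; ring
    rw [this, map_mul, Matrix.aeval_self_charpoly, mul_zero]
  have hid : IsIdempotentElem (aeval Y E) := by
    have e1 : E * E = E - (u * v) * (X ^ (α + m) * q) := by
      have : v * q = 1 - E := by rw [← huv, hE]; ring
      calc E * E = E - E * (1 - E) := by ring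
        _ = _ := by rw [← this, hE]; ring
    rw [IsIdempotentElem, ← map_mul, e1, map_sub, map_mul, hz, mul_zero, sub_zero]
  have hE0 : aeval Y E = 0 := by
    set e := aeval Y E with he
    have hid' : IsIdempotentElem (Matrix.toLin' e) := by
      rw [IsIdempotentElem, Module.End.mul_eq_comp, ← Matrix.toLin'_mul, hid.eq]
    have ht := (LinearMap.IsIdempotentElem.isProj_range _ hid').trace
    rw [Matrix.trace_toLin'_eq, he, hE, htr u, ← hE, ← he] at ht
    set r := Module.finrank K (LinearMap.range (Matrix.toLin' e)) with hr
    have hrn : r ≤ n := by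
      have := Submodule.finrank_le (LinearMap.range (Matrix.toLin' e))
      simpa using this
    have hr0 : r = 0 := by
      by_contra hne
      apply hfac
      obtain ⟨c, hc⟩ := Nat.dvd_factorial (Nat.pos_of_ne_zero hne) hrn
      rw [hc, Nat.cast_mul, ← ht, zero_mul]
    rw [hr, Submodule.finrank_eq_zero, LinearMap.range_eq_bot] at hr0
    exact (LinearEquiv.map_eq_zero_iff _).1 hr0
  refine ⟨α + m, ?_⟩
  have : (X ^ (α + m) : K[X]) = X ^ (α + m) * E + v * (X ^ (α + m) * q) := by
    calc (X ^ (α + m) : K[X]) = X ^ (α + m) * (u * X ^ (α + m) + v * q) := by rw [huv, mul_one]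
      _ = _ := by rw [hE]; ring
  have h2 := congrArg (aeval Y) this
  rw [map_add, map_mul, map_mul, hE0, hz, mul_zero, mul_zero, add_zero] at h2
  simpa using h2

/-- The diagonal case. -/
theorem aux_diag {n : ℕ} {K : Type*} [Field K] (d : Fin n → K) (hd : Function.Injective d)
    (Y : Matrix (Fin n) (Fin n) K) (α : ℕ) (hα : 2 ≤ α)
    (h : Matrix.diagonal d * Y - Y * Matrix.diagonal d = Y ^ α) (hY : IsNilpotent Y) : Y = 0 := by
  obtain ⟨N, hN⟩ := hY
  have hoff : ∀ i j, i ≠ j → ∀ t k, N ≤ k + 1 + t → (Y ^ (k + 1)) i j = 0 := by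
    intro i j hij t
    induction t with
    | zero =>
      intro k hk
      rw [pow_eq_zero_of_le (by simpa using hk) hN]; rfl
    | succ t ih =>
      intro k hk
      have h1 := congrFun (congrFun (aux_comm_pow _ _ α h k) i) j
      have h2 := ih (k + α - 1) (by omega)
      rw [show k + α - 1 + 1 = k + α by omega] at h2
      rw [← nsmul_eq_mul, Matrix.smul_apply, h2, smul_zero, Matrix.sub_apply,
        Matrix.diagonal_mul, Matrix.mul_diagonal, mul_comm _ (d j), ← sub_mul] at h1
      exact (mul_eq_zero.1 h1).resolve_left (sub_ne_zero.2 (hd.ne hij))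
  have hdiag : Y = Matrix.diagonal (fun i => Y i i) := by
    ext i j
    by_cases hij : i = j
    · subst hij; simp
    · rw [Matrix.diagonal_apply_ne _ hij]
      simpa using hoff i j hij N 0 (by omega)
  rw [hdiag, Matrix.diagonal_pow] at hN
  rw [hdiag]
  ext i j
  by_cases hij : i = j
  · subst hij
    have := congrFun (congrFun hN i) i
    simp only [Matrix.diagonal_apply_eq, Matrix.zero_apply, Pi.pow_apply] at this ⊢
    exact eq_zero_of_pow_eq_zero this
  · simp [hij]

/-- The case of a matrix with separable characteristic polynomial over an algebraically closed
field. -/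
theorem aux_sep {n : ℕ} {K : Type*} [Field K] [IsAlgClosed K] (hfac : (n.factorial : K) ≠ 0)
    (M Y : Matrix (Fin n) (Fin n) K) (α : ℕ) (hα : 2 ≤ α)
    (h : M * Y - Y * M = Y ^ α) (hs : M.charpoly.Separable) : Y = 0 := by
  have hnil : IsNilpotent Y := aux_nilp hfac Y α (aux_trace M Y α h)
  classical
  have hcard : M.charpoly.roots.toFinset.card = n := by
    rw [Multiset.toFinset_card_of_nodup (Polynomial.nodup_roots hs),
      ← (IsAlgClosed.splits M.charpoly).natDegree_eq_card_roots, Matrix.charpoly_natDegree_eq_dim,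
      Fintype.card_fin]
  let e := M.charpoly.roots.toFinset.equivFinOfCardEq hcard
  let d : Fin n → K := fun i => (e.symm i : K)
  have hd : Function.Injective d := Subtype.val_injective.comp e.symm.injective
  have hev : ∀ i, ∃ v, Module.End.HasEigenvector (Matrix.toLin' M) (d i) v := by
    intro i
    apply Module.End.HasEigenvalue.exists_hasEigenvector
    rw [Module.End.hasEigenvalue_iff_isRoot_charpoly, Matrix.charpoly_toLin']
    have := (e.symm i).2
    rw [Multiset.mem_toFinset] at this
    exact Polynomial.isRoot_of_mem_roots this
  choose v hv using hev
  have hli := Module.End.eigenvectors_linearIndependent' _ d hd v hv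
  let P : Matrix (Fin n) (Fin n) K := (Matrix.of v).transpose
  have hP : IsUnit P := by
    rw [← Matrix.linearIndependent_cols_iff_isUnit]
    exact hli
  have hMP : M * P = P * Matrix.diagonal d := by
    ext i j
    have := congrFun ((hv j).apply_eq_smul) i
    rw [Matrix.mul_diagonal]
    rw [Matrix.toLin'_apply] at this
    simpa [P, Matrix.mul_apply, Matrix.mulVec, dotProduct, mul_comm] using this
  obtain ⟨Pu, hPu⟩ := hP
  rw [← hPu] at hMP
  have hD : Matrix.diagonal d = Pu⁻¹.val * M * Pu.val := by
    rw [mul_assoc, hMP, Units.inv_mul_cancel_left]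
  have hconj : ∀ k, (Pu⁻¹.val * Y * Pu.val) ^ k
      = Pu⁻¹.val * Y ^ k * Pu.val := fun k => Units.conj_pow' Pu Y k
  have h0 := aux_diag d hd (Pu⁻¹.val * Y * Pu.val) α hα (by
    rw [hconj, ← h, hD]
    simp only [mul_assoc, Units.mul_inv_cancel_left, mul_sub, sub_mul]) (by
    obtain ⟨N, hN⟩ := hnil
    exact ⟨N, by rw [hconj, hN, mul_zero, zero_mul]⟩)
  have h1 : Y = Pu.val * (Pu⁻¹.val * Y * Pu.val) * Pu⁻¹.val := by
    simp [mul_assoc]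
  rw [h1, h0, mul_zero, zero_mul]

open Polynomial in
/-- Nonvanishing of the resultant for separable monic polynomials. -/
theorem aux_res {n : ℕ} (hn : n ≠ 0) {K : Type*} [Field K] (f : K[X]) (hf : f.Monic)
    (hd : f.natDegree = n) : f.resultant (derivative f) n n ≠ 0 ↔ f.Separable := by
  have hle : (derivative f).natDegree ≤ n := (natDegree_derivative_le f).trans (by omega)
  obtain ⟨k, hk⟩ := Nat.exists_eq_add_of_le hle
  have h1 : f.resultant (derivative f) n n = f.resultant (derivative f) := by
    conv_lhs => rw [show f.resultant (derivative f) n n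
      = f.resultant (derivative f) n ((derivative f).natDegree + k) by rw [← hk]]
    rw [resultant_add_right_deg _ _ _ _ _ le_rfl]
    have : f.coeff n = 1 := by rw [← hd]; exact hf
    rw [this, one_pow, one_mul, hd]
  rw [h1, ← isUnit_iff_ne_zero, isUnit_resultant_iff_isCoprime hf]
  rfl

/-- The case of an algebraically closed field. -/
theorem aux_field {n α : ℕ} (hn : 2 ≤ n) (hα : 2 ≤ α) {K : Type*} [Field K] [IsAlgClosed K]
    (hfac : (n.factorial : K) ≠ 0)
    (A : Matrix (Fin n) (Fin n) (MvPolynomial (Fin n × Fin n) K))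
    (hA : ∀ i j, A i j = MvPolynomial.X (i, j))
    (X : Matrix (Fin n) (Fin n) (MvPolynomial (Fin n × Fin n) K))
    (h : A * X - X * A = X ^ α) : X = 0 := by
  have : Infinite K := IsAlgClosed.instInfinite
  set D := A.charpoly.resultant (Polynomial.derivative A.charpoly) n n with hDdef
  have hev : ∀ x : Fin n × Fin n → K, MvPolynomial.eval x D ≠ 0 ↔
      (Matrix.of fun i j => x (i, j)).charpoly.Separable := by
    intro x
    have hm : (Matrix.of fun i j => x (i, j)) = A.map (MvPolynomial.eval x) := by
      ext i j; simp [hA]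
    rw [hm, ← aux_res (n := n) (by omega) _ (Matrix.charpoly_monic _) (by simp),
      Matrix.charpoly_map, Polynomial.derivative_map, Polynomial.resultant_map_map]
  have hD : D ≠ 0 := by
    intro h0
    let g : Fin n ↪ K := (Fin.valEmbedding).trans (Infinite.natEmbedding K)
    have := (hev (fun p => Matrix.diagonal g p.1 p.2)).2 (by
      change (Matrix.diagonal g).charpoly.Separable
      rw [Matrix.charpoly_diagonal, Polynomial.separable_prod_X_sub_C_iff]
      exact g.injective)
    rw [h0, map_zero] at this
    exact this rfl
  ext1 i j
  have hmul : D * X i j = 0 := by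
    apply MvPolynomial.funext
    intro x
    rw [map_mul, map_zero]
    by_cases hx : MvPolynomial.eval x D = 0
    · rw [hx, zero_mul]
    · have hm : (Matrix.of fun i j => x (i, j)) = A.map (MvPolynomial.eval x) := by
        ext i j; simp [hA]
      have hs := (hev x).1 hx
      rw [hm] at hs
      have h1 := congrArg (MvPolynomial.eval x).mapMatrix h
      rw [map_sub, map_mul, map_mul, map_pow] at h1
      have h2 := aux_sep hfac _ _ α hα h1 hs
      have h3 := congrFun (congrFun h2 i) j
      rw [RingHom.mapMatrix_apply, Matrix.map_apply] at h3
      rw [h3]; simp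
  exact (mul_eq_zero.1 hmul).resolve_left hD

/-- Let `n, α ≥ 2` and `R` a reduced commutative ring in which `n!` is
not a zero-divisor. If `A` is the generic `n × n` matrix over `R` (entries are the `n²`
indeterminates of the polynomial ring `R̃ = R[a₁₁, …, aₙₙ]`), then `X = 0` is the only
matrix over `R̃` satisfying `AX - XA = Xᵅ`. -/
theorem stmt8 (n α : ℕ) (hn : 2 ≤ n) (hα : 2 ≤ α)
    (R : Type*) [CommRing R] [IsReduced R]
    (hfac : (n.factorial : R) ∈ nonZeroDivisors R)
    (A : Matrix (Fin n) (Fin n) (MvPolynomial (Fin n × Fin n) R))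
    (hA : ∀ i j, A i j = MvPolynomial.X (i, j))
    (X : Matrix (Fin n) (Fin n) (MvPolynomial (Fin n × Fin n) R))
    (h : A * X - X * A = X ^ α) :
    X = 0 := by
  ext i j m
  rw [Matrix.zero_apply, MvPolynomial.coeff_zero]
  have key : (X i j).coeff m ∈ sInf (minimalPrimes R) := by
    rw [Submodule.mem_sInf]
    intro (P : Ideal R) hP
    have hPp : P.IsPrime := hP.1.1
    let K := AlgebraicClosure (FractionRing (R ⧸ P))
    let φ : R →+* K := (algebraMap (FractionRing (R ⧸ P)) K).comp
      ((algebraMap (R ⧸ P) (FractionRing (R ⧸ P))).comp (Ideal.Quotient.mk P))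
    have hφ : ∀ c, φ c = 0 → c ∈ P := by
      intro c hc
      have h1 : algebraMap (R ⧸ P) (FractionRing (R ⧸ P)) (Ideal.Quotient.mk P c) = 0 :=
        (map_eq_zero (algebraMap (FractionRing (R ⧸ P)) K)).1 hc
      rw [IsFractionRing.to_map_eq_zero_iff] at h1
      exact Ideal.Quotient.eq_zero_iff_mem.1 h1
    apply hφ
    have hf : (n.factorial : K) ≠ 0 := by
      intro h0
      have : (n.factorial : R) ∈ P := hφ _ (by rw [map_natCast, h0])
      exact notMem_nonZeroDivisors_of_mem_mem_minimalPrimes this hP hfac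
    have h1 := congrArg (MvPolynomial.map φ).mapMatrix h
    rw [map_sub, map_mul, map_mul, map_pow] at h1
    have h2 := aux_field hn hα hf _ (fun i j => by
      rw [RingHom.mapMatrix_apply, Matrix.map_apply, hA, MvPolynomial.map_X]) _ h1
    have h3 := congrFun (congrFun h2 i) j
    rw [RingHom.mapMatrix_apply, Matrix.map_apply] at h3
    rw [← MvPolynomial.coeff_map, h3]; simp
  have hr : sInf (minimalPrimes R) = (⊥ : Ideal R).radical := Ideal.sInf_minimalPrimes
  rw [hr] at key
  obtain ⟨k, hk⟩ := key
  exact eq_zero_of_pow_eq_zero (by simpa using hk)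
end

section
/- Let $n, \alpha \geq 2$ and let $R$ be a commutative ring with unity in which $n!$ is not a zero-divisor. Let $A \in M_n(R)$ be similar over $R$ to $\mathrm{diag}(\lambda_1, \dots, \lambda_n)$, where for every $i \neq j$ the element $\lambda_i - \lambda_j$ is not a zero-divisor in $R$. If $X \in M_n(R)$ satisfies $AX - XA = X^{\alpha}$, then there exists $P \in GL_n(R)$ such that $A = P \, \mathrm{diag}(\lambda_1, \dots, \lambda_n) \, P^{-1}$ and $X = P \, \mathrm{diag}(\mu_1, \dots, \mu_n) \, P^{-1}$ where $\mu_i^{\alpha} = 0$ for every $i$. -/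
open Polynomial in
theorem aux_comm {S R : Type*} [CommRing R] [Ring S] [Algebra R S] (D X : S) (a : ℕ)
    (h : D * X - X * D = X ^ (a + 1)) (q : R[X]) :
    D * aeval X q - aeval X q * D = aeval X (derivative q) * X ^ (a + 1) := by
  induction q using Polynomial.induction_on' with
  | add p q hp hq =>
    simp only [map_add, mul_add, add_mul]
    rw [← hp, ← hq]; abel
  | monomial m c =>
    have key : ∀ m : ℕ, D * X ^ m - X ^ m * D = (m : S) * X ^ (m - 1) * X ^ (a + 1) := by
      intro m
      induction m with
      | zero => simp
      | succ k ih =>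
        have e : D * X ^ (k+1) - X ^ (k+1) * D
          = (D * X ^ k - X ^ k * D) * X + X ^ k * (D * X - X * D) := by
          rw [pow_succ]; noncomm_ring
        rw [e, ih, h]
        rcases k with _ | k
        · simp
        · simp only [Nat.add_sub_cancel, mul_assoc, ← pow_add, ← pow_succ]
          push_cast
          rw [add_mul (_ + _) 1, one_mul]
          congr 3 <;> ring
    rw [derivative_monomial, aeval_monomial, aeval_monomial, map_mul, map_natCast,
      ← mul_assoc, ← Algebra.commutes c D, mul_assoc, mul_assoc, ← mul_sub, key]
    simp only [mul_assoc]

open Polynomial in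
theorem aux_nil {n a : ℕ} {R : Type*} [CommRing R]
    (hfac : (n.factorial : R) ∈ nonZeroDivisors R)
    (D X : Matrix (Fin n) (Fin n) R) (h : D * X - X * D = X ^ (a + 1)) :
    X ^ (n * (a + 1)) = 0 := by
  nontriviality R
  have step : ∀ j : ℕ, aeval X (derivative^[j] X.charpoly) * X ^ (j * (a + 1)) = 0 := by
    intro j
    induction j with
    | zero => simpa using Matrix.aeval_self_charpoly X
    | succ j ih =>
      have h1 : aeval X (derivative^[j] X.charpoly * Polynomial.X ^ (j * (a + 1)) : R[X]) = 0 := by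
        simpa using ih
      have h2 := aux_comm D X a h (derivative^[j] X.charpoly * Polynomial.X ^ (j * (a + 1)))
      rw [h1] at h2
      simp only [derivative_mul, mul_zero, zero_mul, sub_zero, map_add, map_mul, map_pow, aeval_X,
        derivative_X_pow, add_mul, ← Function.iterate_succ_apply' (f := derivative)] at h2
      rcases j with _ | j
      · simpa using h2.symm
      · have h3 : aeval X (derivative^[j+1] X.charpoly) *
            (aeval X (C (((j+1) * (a+1) : ℕ) : R)) * X ^ ((j+1) * (a+1) - 1)) * X ^ (a+1) = 0 := by
          have e : X ^ ((j+1) * (a+1) - 1) * X ^ (a+1) = X ^ ((j+1) * (a+1)) * X ^ a := by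
            rw [← pow_add, ← pow_add]; congr 1
            have : 1 ≤ (j+1) * (a+1) := Nat.mul_pos (by omega) (by omega)
            omega
          rw [mul_assoc, mul_assoc, e, aeval_C, ← mul_assoc, ← Algebra.commutes, mul_assoc,
            ← mul_assoc (aeval X _), ih]
          simp
        rw [h3, add_zero, mul_assoc, ← pow_add] at h2
        rw [h2]; congr 2; ring
  have hn := step n
  have hd : derivative^[n] X.charpoly = C (n.factorial : R) := by
    have hdeg : X.charpoly.natDegree = n := by simp
    ext i
    rw [coeff_iterate_derivative, coeff_C]
    split_ifs with hi
    · subst hi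
      have := X.charpoly_monic
      rw [Monic, leadingCoeff, hdeg] at this
      simp [this, Nat.descFactorial_self]
    · rw [coeff_eq_zero_of_natDegree_lt (by omega)]; simp
  rw [hd, aeval_C] at hn
  ext i j
  have := congrFun (congrFun hn i) j
  rw [← Algebra.smul_def, Matrix.smul_apply, smul_eq_mul, mul_comm] at this
  exact (mul_right_mem_nonZeroDivisors_eq_zero_iff hfac).1 this

theorem aux_diag_s12 {n a : ℕ} (ha : 1 ≤ a) {R : Type*} [CommRing R]
    (hfac : (n.factorial : R) ∈ nonZeroDivisors R) (lam : Fin n → R)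
    (hreg : ∀ i j, i ≠ j → lam i - lam j ∈ nonZeroDivisors R)
    (X : Matrix (Fin n) (Fin n) R)
    (h : Matrix.diagonal lam * X - X * Matrix.diagonal lam = X ^ (a + 1)) :
    ∃ μ : Fin n → R, X = Matrix.diagonal μ ∧ ∀ i, μ i ^ (a + 1) = 0 := by
  have hnil := aux_nil hfac _ X h
  have key : ∀ k m : ℕ, n * (a + 1) ≤ m + k → ∀ i j, i ≠ j → (X ^ m) i j = 0 := by
    intro k
    induction k with
    | zero =>
      intro m hm i j _
      rw [pow_eq_zero_of_le (show n * (a + 1) ≤ m from hm) hnil]; rfl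
    | succ k ih =>
      intro m hm i j hij
      have h1 := aux_comm (R := R) _ X a h (Polynomial.X ^ m)
      have h2 := congrFun (congrFun h1 i) j
      rcases m with _ | m
      · simp [hij]
      have h3 := ih (m + (a + 1)) (by omega) i j hij
      simp only [map_pow, Polynomial.aeval_X, Polynomial.derivative_X_pow, map_mul,
        Polynomial.aeval_C, mul_assoc, Nat.add_sub_cancel, ← pow_add] at h2
      rw [← Algebra.smul_def, Matrix.smul_apply, h3, smul_zero, Matrix.sub_apply,
        Matrix.diagonal_mul, Matrix.mul_diagonal, mul_comm, ← mul_sub] at h2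
      exact (mul_right_mem_nonZeroDivisors_eq_zero_iff (hreg i j hij)).1 h2
  have hX : X = Matrix.diagonal (fun i => X i i) := by
    ext i j
    by_cases hij : i = j
    · subst hij; simp
    · rw [Matrix.diagonal_apply_ne _ hij]
      simpa using key (n * (a + 1)) 1 (by omega) i j hij
  refine ⟨fun i => X i i, hX, fun i => ?_⟩
  have h4 := congrFun (congrFun h i) i
  rw [Matrix.sub_apply, Matrix.diagonal_mul, Matrix.mul_diagonal, mul_comm, sub_self, hX,
    Matrix.diagonal_pow, Matrix.diagonal_apply_eq] at h4
  simpa using h4.symm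


/-- Let `n, α ≥ 2` and `R` a commutative ring in which `n!` is not a
zero-divisor. Let `A ∈ Mₙ(R)` be similar over `R` to `diag(λ₁, …, λₙ)` where each
`λᵢ - λⱼ` (`i ≠ j`) is not a zero-divisor. If `X` satisfies `AX - XA = Xᵅ`, then there
is `P ∈ GLₙ(R)` with `A = P diag(λ₁, …, λₙ) P⁻¹` and `X = P diag(μ₁, …, μₙ) P⁻¹` where
`μᵢᵅ = 0` for every `i`. -/
theorem stmt12 (n α : ℕ) (hn : 2 ≤ n) (hα : 2 ≤ α)
    (R : Type*) [CommRing R]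
    (hfac : (n.factorial : R) ∈ nonZeroDivisors R)
    (lam : Fin n → R)
    (hreg : ∀ i j, i ≠ j → lam i - lam j ∈ nonZeroDivisors R)
    (A : Matrix (Fin n) (Fin n) R)
    (hA : ∃ Q : GL (Fin n) R,
      A = (Q : Matrix (Fin n) (Fin n) R) * Matrix.diagonal lam *
        ((Q⁻¹ : GL (Fin n) R) : Matrix (Fin n) (Fin n) R))
    (X : Matrix (Fin n) (Fin n) R)
    (h : A * X - X * A = X ^ α) :
    ∃ (P : GL (Fin n) R) (μ : Fin n → R),
      A = (P : Matrix (Fin n) (Fin n) R) * Matrix.diagonal lam *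
        ((P⁻¹ : GL (Fin n) R) : Matrix (Fin n) (Fin n) R) ∧
      X = (P : Matrix (Fin n) (Fin n) R) * Matrix.diagonal μ *
        ((P⁻¹ : GL (Fin n) R) : Matrix (Fin n) (Fin n) R) ∧
      ∀ i, μ i ^ α = 0 := by
  obtain ⟨Q, hQ⟩ := hA
  obtain ⟨a, rfl⟩ : ∃ a, α = a + 1 := ⟨α - 1, by omega⟩
  have hpow : ∀ m : ℕ, ((Q⁻¹ : GL (Fin n) R) : Matrix (Fin n) (Fin n) R) * X ^ m * Q.1
      = (((Q⁻¹ : GL (Fin n) R) : Matrix (Fin n) (Fin n) R) * X * Q.1) ^ m :=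
    fun m => (Units.conj_pow' Q X m).symm
  have i1 : ((Q⁻¹ : GL (Fin n) R) : Matrix (Fin n) (Fin n) R) * Q.1 = 1 := Q.inv_mul
  have i2 : Q.1 * ((Q⁻¹ : GL (Fin n) R) : Matrix (Fin n) (Fin n) R) = 1 := Q.mul_inv
  obtain ⟨μ, hμ, hz⟩ := aux_diag_s12 (a := a) (by omega) hfac lam hreg
    (((Q⁻¹ : GL (Fin n) R) : Matrix (Fin n) (Fin n) R) * X * Q.1) (by
      rw [← hpow, ← h, hQ]
      generalize ((Q⁻¹ : GL (Fin n) R) : Matrix (Fin n) (Fin n) R) = V at *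
      generalize Q.1 = U at *
      generalize Matrix.diagonal lam = D at *
      rw [mul_sub, sub_mul]
      congr 1
      · calc D * (V * X * U) = 1 * D * V * X * U := by simp only [one_mul, mul_assoc]
          _ = _ := by rw [← i1]; simp only [mul_assoc]
      · calc (V * X * U) * D = V * X * U * D * 1 := by simp only [mul_one]
          _ = _ := by rw [← i1]; simp only [mul_assoc])
  refine ⟨Q, μ, hQ, ?_, hz⟩
  rw [← hμ]
  calc X = (Q.1 * ((Q⁻¹ : GL (Fin n) R) : Matrix (Fin n) (Fin n) R)) * X *
        (Q.1 * ((Q⁻¹ : GL (Fin n) R) : Matrix (Fin n) (Fin n) R)) := by rw [i2]; simp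
    _ = _ := by simp only [mul_assoc]
end
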